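/- Fix $\beta_0 \in (0,1)$ and an integer $k \ge 2$. For the excited random walk on $\mathbb{Z}^d$, the Radon–Nikodym density of $\mathbb{P}_\beta$ with respect to $\mathbb{P}_0$ (simple symmetric walk) restricted to the first $n$ steps is $M_n(\beta) = \prod_{i=0}^{n-1}(1 + \beta \mathcal{E}_i \mathbf{1}_{Y_i \notin})$, where $\mathcal{E}_i = (Y_{i+1}-Y_i)\cdot e_1 \in \{-1,0,1\}$ and $\mathbf{1}_{Y_i \notin}$ indicates $Y_i$ is at a fresh site. Then for all $n \ge k$: $|\mathbb{P}_\beta(Y_n \notin_k) - \mathbb{P}_0(Y_n \notin_k)| \le (1+\beta)^{k-1} - 1$. -/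

import Mathlib

noncomputable section
open scoped Classical

/-- The unit step of a nearest-neighbor walk on `ℤ^d` encoded by a direction and a sign. -/
def stepVec (d : ℕ) (s : Fin d × Bool) : Fin d → ℤ :=
  (if s.2 then (1 : ℤ) else -1) • Pi.single s.1 (1 : ℤ)

/-- The position after `n` steps of the path with step sequence `σ`. -/
def pathPos {d k : ℕ} (σ : Fin k → Fin d × Bool) (n : ℕ) : Fin d → ℤ :=
  ∑ i : Fin k, if (i : ℕ) < n then stepVec d (σ i) else 0

/-- One-step probability of the simple random walk on `ℤ^d` with bias `β` in direction `e₁`. -/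
def srwWeight (d : ℕ) [NeZero d] (β : ℝ) (s : Fin d × Bool) : ℝ :=
  if s.1 = 0 then (if s.2 then (1 + β) / (2 * d) else (1 - β) / (2 * d))
  else 1 / (2 * d)

/-- The walk is at a previously unvisited ("fresh") site at time `i`. -/
def freshAt {d n : ℕ} (σ : Fin n → Fin d × Bool) (i : ℕ) : Prop :=
  ∀ j < i, pathPos σ j ≠ pathPos σ i

/-- The probability of the `n`-step path `σ` under the excited random walk with bias `β`;
this equals the symmetric-walk probability times the density `M_n(β) = ∏ (1 + β ℰ_i 1_{Y_i ∉})`. -/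
def erwPathWeight (d : ℕ) [NeZero d] (β : ℝ) (n : ℕ) (σ : Fin n → Fin d × Bool) : ℝ :=
  ∏ i : Fin n, if freshAt σ (i : ℕ) then srwWeight d β (σ i) else 1 / (2 * d)

/-- `P_β(E)` for an event `E` depending on the first `n` steps of the excited random walk. -/
def erwProb (d : ℕ) [NeZero d] (β : ℝ) (n : ℕ)
    (E : (Fin n → Fin d × Bool) → Prop) : ℝ :=
  ∑ σ : Fin n → Fin d × Bool, if E σ then erwPathWeight d β n σ else 0

/-- The component along `e₁` of a unit step. -/
def stepDrift (d : ℕ) [NeZero d] (s : Fin d × Bool) : ℝ :=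
  if s.1 = 0 then (if s.2 then 1 else -1) else 0

theorem abs_stepDrift_le (d : ℕ) [NeZero d] (s : Fin d × Bool) : |stepDrift d s| ≤ 1 := by
  unfold stepDrift
  split_ifs <;> simp

/-- The `i`-th factor of the density of the excited random walk. -/
def densityFactor (d : ℕ) [NeZero d] (β : ℝ) {n : ℕ} (σ : Fin n → Fin d × Bool) (i : ℕ) : ℝ :=
  if h : i < n then 1 + β * (if freshAt σ i then stepDrift d (σ ⟨i, h⟩) else 0) else 1

/-- The density `M_j(β)` of the excited random walk restricted to the first `j` steps. -/
def density (d : ℕ) [NeZero d] (β : ℝ) {n : ℕ} (σ : Fin n → Fin d × Bool) (j : ℕ) : ℝ :=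
  ∏ i ∈ Finset.range j, densityFactor d β σ i

theorem abs_densityFactor_sub_one_le (d : ℕ) [NeZero d] {β : ℝ} (hβ : 0 ≤ β) {n : ℕ}
    (σ : Fin n → Fin d × Bool) (i : ℕ) : |densityFactor d β σ i - 1| ≤ β := by
  unfold densityFactor
  split_ifs with h h'
  · rw [add_sub_cancel_left, abs_mul, abs_of_nonneg hβ]
    exact mul_le_of_le_one_right hβ (abs_stepDrift_le d _)
  · simpa using hβ
  · simpa using hβ

theorem density_nonneg (d : ℕ) [NeZero d] {β : ℝ} (hβ : 0 ≤ β) (hβ1 : β ≤ 1) {n : ℕ}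
    (σ : Fin n → Fin d × Bool) (j : ℕ) : 0 ≤ density d β σ j := by
  refine Finset.prod_nonneg fun i _ => ?_
  have := abs_le.1 (abs_densityFactor_sub_one_le d hβ σ i)
  linarith [this.1]

theorem abs_prod_range_sub_one_le {β : ℝ} (f : ℕ → ℝ)
    (hf : ∀ i, |f i - 1| ≤ β) (m : ℕ) :
    |∏ i ∈ Finset.range m, f i - 1| ≤ (1 + β) ^ m - 1 := by
  induction m with
  | zero => simp
  | succ m ih =>
    rw [Finset.prod_range_succ, pow_succ]
    set p := ∏ i ∈ Finset.range m, f i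
    have hfm : |f m| ≤ 1 + β := by
      have := abs_add_le (f m - 1) 1
      rw [sub_add_cancel, abs_one] at this
      linarith [hf m]
    calc |p * f m - 1| = |(p - 1) * f m + (f m - 1)| := by ring_nf
      _ ≤ |p - 1| * |f m| + |f m - 1| := by
        rw [← abs_mul]
        exact abs_add_le _ _
      _ ≤ ((1 + β) ^ m - 1) * (1 + β) + β :=
        add_le_add (mul_le_mul ih hfm (abs_nonneg _) ((abs_nonneg _).trans ih)) (hf m)
      _ = (1 + β) ^ m * (1 + β) - 1 := by ring

theorem erwPathWeight_eq_density (d : ℕ) [NeZero d] (β : ℝ) (n : ℕ)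
    (σ : Fin n → Fin d × Bool) :
    erwPathWeight d β n σ = (1 / (2 * d) : ℝ) ^ n * density d β σ n := by
  unfold erwPathWeight density
  rw [Finset.prod_range, ← Fin.prod_const, ← Finset.prod_mul_distrib]
  refine Finset.prod_congr rfl fun i _ => ?_
  simp only [densityFactor, i.isLt, dite_true, Fin.eta, srwWeight, stepDrift]
  split_ifs <;> ring

theorem density_zero_bias (d : ℕ) [NeZero d] {n : ℕ} (σ : Fin n → Fin d × Bool) (j : ℕ) :
    density d 0 σ j = 1 := by
  simp [density, densityFactor]

/-- Reflection of a step in the hyperplane orthogonal to `e₁`. -/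
def reflectStep {d : ℕ} [NeZero d] (s : Fin d × Bool) : Fin d × Bool :=
  if s.1 = 0 then (s.1, !s.2) else s

/-- Reflection of `ℤ^d` in the hyperplane orthogonal to `e₁`. -/
def reflectVec (d : ℕ) [NeZero d] : (Fin d → ℤ) →+ (Fin d → ℤ) where
  toFun v i := if i = 0 then -v i else v i
  map_zero' := by ext; simp
  map_add' v w := by
    ext i
    by_cases h : i = 0 <;> simp [h, add_comm]

theorem reflectVec_injective (d : ℕ) [NeZero d] : Function.Injective (reflectVec d) := by
  intro v w h
  ext i
  have := congrFun h i
  simp only [reflectVec, AddMonoidHom.coe_mk, ZeroHom.coe_mk] at this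
  split_ifs at this <;> lia

theorem reflectStep_involutive {d : ℕ} [NeZero d] :
    Function.Involutive (reflectStep (d := d)) := by
  rintro ⟨a, b⟩
  by_cases h : a = 0 <;> simp [reflectStep, h]

theorem stepVec_reflectStep {d : ℕ} [NeZero d] (s : Fin d × Bool) :
    stepVec d (reflectStep s) = reflectVec d (stepVec d s) := by
  obtain ⟨a, b⟩ := s
  ext i
  by_cases h : a = 0 <;> by_cases hi : i = 0 <;> by_cases hai : i = a <;> cases b <;>
    simp_all [reflectStep, reflectVec, stepVec]

theorem stepDrift_reflectStep {d : ℕ} [NeZero d] (s : Fin d × Bool) :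
    stepDrift d (reflectStep s) = -stepDrift d s := by
  obtain ⟨a, b⟩ := s
  by_cases h : a = 0 <;> cases b <;> simp [stepDrift, reflectStep, h]

/-- Reflection of all steps of a path from time `j` on. -/
def reflectFrom {d n : ℕ} [NeZero d] (j : ℕ) (σ : Fin n → Fin d × Bool) : Fin n → Fin d × Bool :=
  fun i => if (i : ℕ) < j then σ i else reflectStep (σ i)

theorem reflectFrom_involutive {d n : ℕ} [NeZero d] (j : ℕ) :
    Function.Involutive (reflectFrom (d := d) (n := n) j) := by
  intro σ
  ext1 i
  by_cases h : (i : ℕ) < j <;> simp [reflectFrom, h, reflectStep_involutive (σ i)]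

theorem pathPos_reflectFrom_of_le {d n : ℕ} [NeZero d] {i j : ℕ} (hij : i ≤ j)
    (σ : Fin n → Fin d × Bool) : pathPos (reflectFrom j σ) i = pathPos σ i := by
  refine Finset.sum_congr rfl fun a _ => ?_
  by_cases h : (a : ℕ) < i
  · simp [h, reflectFrom, h.trans_le hij]
  · simp [h]

theorem pathPos_reflectFrom_of_ge {d n : ℕ} [NeZero d] {i j : ℕ} (hij : j ≤ i)
    (σ : Fin n → Fin d × Bool) :
    pathPos (reflectFrom j σ) i = pathPos σ j + reflectVec d (pathPos σ i - pathPos σ j) := by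
  unfold pathPos
  rw [← Finset.sum_sub_distrib, map_sum, ← Finset.sum_add_distrib]
  refine Finset.sum_congr rfl fun a _ => ?_
  by_cases h : (a : ℕ) < j
  · simp [h, h.trans_le hij, reflectFrom]
  · by_cases h' : (a : ℕ) < i <;> simp [h, h', reflectFrom, stepVec_reflectStep]

theorem pathPos_reflectFrom_eq_iff {d n : ℕ} [NeZero d] {i l j : ℕ} (hi : j ≤ i) (hl : j ≤ l)
    (σ : Fin n → Fin d × Bool) :
    pathPos (reflectFrom j σ) i = pathPos (reflectFrom j σ) l ↔ pathPos σ i = pathPos σ l := by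
  rw [pathPos_reflectFrom_of_ge hi, pathPos_reflectFrom_of_ge hl, add_right_inj,
    (reflectVec_injective d).eq_iff, sub_left_inj]

theorem freshAt_reflectFrom {d n : ℕ} [NeZero d] {i j : ℕ} (hij : i ≤ j)
    (σ : Fin n → Fin d × Bool) : freshAt (reflectFrom j σ) i ↔ freshAt σ i := by
  unfold freshAt
  refine forall₂_congr fun l hl => ?_
  rw [pathPos_reflectFrom_of_le hij, pathPos_reflectFrom_of_le (hl.le.trans hij)]

theorem density_reflectFrom {d n : ℕ} [NeZero d] (β : ℝ) (j : ℕ) (σ : Fin n → Fin d × Bool) :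
    density d β (reflectFrom j σ) j = density d β σ j := by
  refine Finset.prod_congr rfl fun i hi => ?_
  have hij := Finset.mem_range.1 hi
  simp only [densityFactor, freshAt_reflectFrom hij.le, reflectFrom, hij, if_true]

theorem densityFactor_reflectFrom {d n : ℕ} [NeZero d] (β : ℝ) (j : ℕ)
    (σ : Fin n → Fin d × Bool) :
    densityFactor d β (reflectFrom j σ) j - 1 = -(densityFactor d β σ j - 1) := by
  unfold densityFactor
  split_ifs with h h₁ h₂ h₂
  · simp [reflectFrom, stepDrift_reflectStep]
  · exact absurd ((freshAt_reflectFrom le_rfl σ).1 h₁) h₂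
  · exact absurd ((freshAt_reflectFrom le_rfl σ).2 h₂) h₁
  · simp
  · simp

theorem sum_density_eq_card {d n : ℕ} [NeZero d] (β : ℝ) (E : (Fin n → Fin d × Bool) → Prop)
    (m : ℕ) (hE : ∀ j < m, ∀ σ, E (reflectFrom j σ) ↔ E σ) :
    ∑ σ, (if E σ then density d β σ m else 0) = ∑ σ, if E σ then (1 : ℝ) else 0 := by
  induction m with
  | zero => simp [density]
  | succ m ih =>
    rw [← ih fun j hj => hE j (hj.trans m.lt_succ_self), ← sub_eq_zero,
      ← Finset.sum_sub_distrib]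
    set g : (Fin n → Fin d × Bool) → ℝ := fun σ =>
      (if E σ then density d β σ (m + 1) else 0) - if E σ then density d β σ m else 0 with hg
    have hg' : ∀ σ, g σ = if E σ then density d β σ m * (densityFactor d β σ m - 1) else 0 := by
      intro σ
      by_cases h : E σ
      · simp only [hg, h, if_true, density, Finset.prod_range_succ]
        ring
      · simp [hg, h]
    have hneg : ∀ σ, g (reflectFrom m σ) = -g σ := by
      intro σ
      rw [hg', hg', density_reflectFrom, densityFactor_reflectFrom]
      by_cases h : E σ <;> simp only [hE m m.lt_succ_self, h, if_true, if_false, mul_neg, neg_zero]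
    have hsum : ∑ σ, g (reflectFrom m σ) = ∑ σ, g σ :=
      Equiv.sum_comp (reflectFrom_involutive m).toPerm g
    simp only [hneg, Finset.sum_neg_distrib] at hsum
    linarith

theorem abs_erwProb_sub_le {d n : ℕ} [NeZero d] {β : ℝ} (hβ : 0 ≤ β) (hβ1 : β ≤ 1)
    (E : (Fin n → Fin d × Bool) → Prop) (m : ℕ) (hm : m ≤ n)
    (hE : ∀ j < m, ∀ σ, E (reflectFrom j σ) ↔ E σ) :
    |erwProb d β n E - erwProb d 0 n E| ≤ (1 + β) ^ (n - m) - 1 := by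
  have hd : (0 : ℝ) < d := by exact_mod_cast Nat.pos_of_neZero d
  have hc : 0 ≤ (1 + β) ^ (n - m) - 1 := sub_nonneg.2 (one_le_pow₀ (by linarith))
  have hprob : ∀ b : ℝ, erwProb d b n E =
      (1 / (2 * d) : ℝ) ^ n * ∑ σ, if E σ then density d b σ n else 0 := by
    intro b
    simp only [erwProb, erwPathWeight_eq_density, Finset.mul_sum, mul_ite, mul_zero]
  have hcard := sum_density_eq_card β E m hE
  have hle : ∑ σ, (if E σ then (1 : ℝ) else 0) ≤ (2 * d : ℝ) ^ n := by
    calc ∑ σ, (if E σ then (1 : ℝ) else 0) ≤ ∑ _σ : Fin n → Fin d × Bool, (1 : ℝ) :=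
          Finset.sum_le_sum fun σ _ => by split_ifs <;> norm_num
      _ = (2 * d : ℝ) ^ n := by simp [mul_comm]
  have hdiff : ∀ σ : Fin n → Fin d × Bool, |density d β σ n - density d β σ m| ≤
      density d β σ m * ((1 + β) ^ (n - m) - 1) := by
    intro σ
    have hsplit : density d β σ n = density d β σ m *
        ∏ i ∈ Finset.range (n - m), densityFactor d β σ (m + i) := by
      rw [density, density, ← Finset.prod_range_add, Nat.add_sub_cancel' hm]
    rw [hsplit, ← mul_sub_one, abs_mul, abs_of_nonneg (density_nonneg d hβ hβ1 σ m)]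
    exact mul_le_mul_of_nonneg_left
      (abs_prod_range_sub_one_le _ (fun i => abs_densityFactor_sub_one_le d hβ σ (m + i)) _)
      (density_nonneg d hβ hβ1 σ m)
  rw [hprob, hprob, ← mul_sub, abs_mul, abs_of_nonneg (by positivity)]
  simp only [density_zero_bias]
  rw [← hcard, ← Finset.sum_sub_distrib]
  calc _ ≤ (1 / (2 * d) : ℝ) ^ n *
        ∑ σ, (if E σ then density d β σ m else 0) * ((1 + β) ^ (n - m) - 1) := by
        gcongr
        refine (Finset.abs_sum_le_sum_abs _ _).trans (Finset.sum_le_sum fun σ _ => ?_)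
        by_cases h : E σ
        · simpa [h] using hdiff σ
        · simp [h]
    _ ≤ (1 / (2 * d) : ℝ) ^ n * ((2 * d : ℝ) ^ n * ((1 + β) ^ (n - m) - 1)) := by
        rw [← Finset.sum_mul, hcard]
        gcongr
    _ = (1 + β) ^ (n - m) - 1 := by
        rw [← mul_assoc, ← mul_pow, one_div_mul_cancel (by positivity), one_pow, one_mul]

/-- for the excited random walk with bias `β ∈ (0,1)`, `k ≥ 2` and `n ≥ k`,
`|P_β(Y_n ∉_k) - P_0(Y_n ∉_k)| ≤ (1+β)^{k-1} - 1`, where `P_0` is the law of the simple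
symmetric walk and `{Y_n ∉_k}` is the event `Y_n ∉ {Y_{n-1}, …, Y_{n-k}}`. -/
theorem stmt12 (d : ℕ) [NeZero d] (β : ℝ) (hβ : β ∈ Set.Ioo (0 : ℝ) 1)
    (k : ℕ) (hk : 2 ≤ k) (n : ℕ) (hn : k ≤ n) :
    |erwProb d β n (fun σ => ∀ j, n - k ≤ j → j < n → pathPos σ j ≠ pathPos σ n) -
      erwProb d 0 n (fun σ => ∀ j, n - k ≤ j → j < n → pathPos σ j ≠ pathPos σ n)| ≤
    (1 + β) ^ (k - 1) - 1 := by
  have hm : n - (n - k + 1) = k - 1 := by lia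
  rw [← hm]
  refine abs_erwProb_sub_le hβ.1.le hβ.2.le _ _ (by lia) fun j hj σ => ?_
  refine forall₃_congr fun i hi hin => ?_
  rw [ne_eq, ne_eq, pathPos_reflectFrom_eq_iff (by lia) (by lia)]
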